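/- For every ontology O, concepts C, D, and label x: O ⊨ C ⊑ D if and only if S(O) ⊩ ∅ ⊢ x : O̅, x : ¬̇C ⊔ D. -/

import Mathlib

set_option maxHeartbeats 1000000

namespace RIQ

/-- Roles: role names and inverse roles. -/
inductive Role : Type
  | name : ℕ → Role
  | inv  : ℕ → Role
deriving DecidableEq

/-- The inverse of a role. -/
def Role.invert : Role → Role
  | .name r => .inv r
  | .inv r  => .name r

/-- RIQ concepts in negation normal form. -/
inductive Concept : Type
  | atom : ℕ → Concept
  | nneg : ℕ → Concept
  | inter : Concept → Concept → Concept
  | union : Concept → Concept → Concept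
  | ex : Role → Concept → Concept
  | all : Role → Concept → Concept
  | atMost : ℕ → Role → Concept → Concept
  | atLeast : ℕ → Role → Concept → Concept
deriving DecidableEq

/-- ⊤ := A₀ ⊔ ¬A₀ for the fixed concept name A₀ = 0. -/
def topC : Concept := .union (.atom 0) (.nneg 0)

/-- ⊥ := A₀ ⊓ ¬A₀ for the fixed concept name A₀ = 0. -/
def botC : Concept := .inter (.atom 0) (.nneg 0)

/-- NNF-negation. -/
def nnfNeg : Concept → Concept
  | .atom A => .nneg A
  | .nneg A => .atom A
  | .inter C D => .union (nnfNeg C) (nnfNeg D)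
  | .union C D => .inter (nnfNeg C) (nnfNeg D)
  | .ex r C => .all r (nnfNeg C)
  | .all r C => .ex r (nnfNeg C)
  | .atMost n r C => .atLeast (n+1) r C
  | .atLeast 0 _ _ => botC
  | .atLeast (n+1) r C => .atMost n r C

/-- Literals: concept names and their negations. -/
def IsLiteral : Concept → Prop
  | .atom _ => True
  | .nneg _ => True
  | _ => False

/-- A complex role inclusion axiom r₁ ∘ ⋯ ∘ rₙ ⊑ s. -/
structure RIA where
  lhs : List Role
  rhs : Role
deriving DecidableEq

/-- An ontology: a finite set of RIAs (RBox) together with a finite set of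
GCIs (TBox), each GCI ⊤ ⊑ C being recorded by its right-hand concept C. -/
structure Ontology where
  rias : Finset RIA
  gcis : Finset Concept

/-- Union of two ontologies. -/
def Ontology.union (O₁ O₂ : Ontology) : Ontology := ⟨O₁.rias ∪ O₂.rias, O₁.gcis ∪ O₂.gcis⟩

/-- Concept names occurring in a concept. -/
def cnames : Concept → Finset ℕ
  | .atom A => {A}
  | .nneg A => {A}
  | .inter C D => cnames C ∪ cnames D
  | .union C D => cnames C ∪ cnames D
  | .ex _ C => cnames C
  | .all _ C => cnames C
  | .atMost _ _ C => cnames C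
  | .atLeast _ _ C => cnames C

/-- Concept names occurring in an ontology. -/
def Ontology.cnames (O : Ontology) : Finset ℕ := O.gcis.sup RIQ.cnames

/-- An interpretation over the domain δ. -/
structure Interp (δ : Type) where
  cI : ℕ → Set δ
  rI : ℕ → Set (δ × δ)

/-- Interpretation of roles. -/
def Interp.roleI {δ : Type} (I : Interp δ) : Role → Set (δ × δ)
  | .name r => I.rI r
  | .inv r  => {p | (p.2, p.1) ∈ I.rI r}

/-- Relational composition of a list of roles (empty composition is the identity). -/
def Interp.listComp {δ : Type} (I : Interp δ) : List Role → Set (δ × δ)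
  | [] => {p | p.1 = p.2}
  | r :: rs => {p | ∃ b, (p.1, b) ∈ I.roleI r ∧ (b, p.2) ∈ I.listComp rs}

/-- Interpretation of concepts. -/
def Interp.cInterp {δ : Type} (I : Interp δ) : Concept → Set δ
  | .atom A => I.cI A
  | .nneg A => (I.cI A)ᶜ
  | .inter C D => I.cInterp C ∩ I.cInterp D
  | .union C D => I.cInterp C ∪ I.cInterp D
  | .ex r C => {a | ∃ b, (a, b) ∈ I.roleI r ∧ b ∈ I.cInterp C}
  | .all r C => {a | ∀ b, (a, b) ∈ I.roleI r → b ∈ I.cInterp C}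
  | .atMost n r C => {a | {b | (a, b) ∈ I.roleI r ∧ b ∈ I.cInterp C}.encard ≤ (n : ℕ∞)}
  | .atLeast n r C => {a | (n : ℕ∞) ≤ {b | (a, b) ∈ I.roleI r ∧ b ∈ I.cInterp C}.encard}

/-- I ⊨ O. -/
def Interp.models {δ : Type} (I : Interp δ) (O : Ontology) : Prop :=
  (∀ C ∈ O.gcis, I.cInterp topC ⊆ I.cInterp C) ∧
  (∀ ria ∈ O.rias, I.listComp ria.lhs ⊆ I.roleI ria.rhs)

/-- O ⊨ C ⊑ D. -/
def entails (O : Ontology) (C D : Concept) : Prop :=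
  ∀ (δ : Type) [Nonempty δ] (I : Interp δ), I.models O → I.cInterp C ⊆ I.cInterp D

/-- Production rules of the R-system G(O). -/
def ProdRule (O : Ontology) (s : Role) (T : List Role) : Prop :=
  ∃ ria ∈ O.rias, (s = ria.rhs ∧ T = ria.lhs) ∨
    (s = ria.rhs.invert ∧ T = (ria.lhs.map Role.invert).reverse)

/-- One-step derivation in the R-system G(O). -/
def OneStep (O : Ontology) (S R : List Role) : Prop :=
  ∃ S' s T R', ProdRule O s T ∧ S = S' ++ s :: R' ∧ R = S' ++ T ++ R'

/-- The language L_{G(O)}(r). -/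
def lang (O : Ontology) (r : Role) : Set (List Role) :=
  {S | Relation.ReflTransGen (OneStep O) [r] S}

/-- Structural atoms: role atoms, equality atoms and inequality atoms
(labels are natural numbers). -/
inductive SAtom : Type
  | rel : Role → ℕ → ℕ → SAtom
  | eq : ℕ → ℕ → SAtom
  | neq : ℕ → ℕ → SAtom
deriving DecidableEq

/-- Labels occurring in a structural atom. -/
def SAtom.labels : SAtom → Finset ℕ
  | .rel _ x y => {x, y}
  | .eq x y => {x, y}
  | .neq x y => {x, y}

/-- Labeled concepts. -/
abbrev LC := ℕ × Concept

/-- Labels occurring in a finite set of structural atoms. -/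
def labSetF (Γ : Finset SAtom) : Finset ℕ := Γ.biUnion SAtom.labels

/-- Labels occurring in a multiset of labeled concepts. -/
def Δlabels (Δ : Multiset LC) : Finset ℕ := (Δ.map Prod.fst).toFinset

/-- One step of the equality chain x ≈ y (an equality atom in either orientation). -/
def eqStep (Γ : Set SAtom) (x y : ℕ) : Prop := SAtom.eq x y ∈ Γ ∨ SAtom.eq y x ∈ Γ

/-- x ∼_Γ y : x and y are linked by a finite chain of equality atoms of Γ. -/
def eqRel (Γ : Set SAtom) : ℕ → ℕ → Prop := Relation.ReflTransGen (eqStep Γ)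

/-- Edge of the propagation graph PG(Γ) between the classes of x and y, labeled r. -/
def pgEdge (Γ : Set SAtom) (x : ℕ) (r : Role) (y : ℕ) : Prop :=
  (∃ z w, eqRel Γ x z ∧ eqRel Γ y w ∧ SAtom.rel r z w ∈ Γ) ∨
  (∃ z w, eqRel Γ y z ∧ eqRel Γ x w ∧ SAtom.rel r.invert z w ∈ Γ)

/-- Propagation paths: PG(Γ) ⊨ [x]_Γ ⟶^S [y]_Γ for a string S of roles. -/
def pgPath (Γ : Set SAtom) : List Role → ℕ → ℕ → Prop
  | [], x, y => eqRel Γ x y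
  | r :: S, x, y => ∃ z, pgEdge Γ x r z ∧ pgPath Γ S z y

/-- PG(Γ) ⊨ [x]_Γ ⟶^L [y]_Γ with L = L_{G(O)}(r). -/
def pgLang (Γ : Set SAtom) (O : Ontology) (r : Role) (x y : ℕ) : Prop :=
  ∃ S ∈ lang O r, pgPath Γ S x y

/-- The edge relation of the directed graph determined by the role atoms of Γ. -/
def edgeRel (Γ : Set SAtom) (x y : ℕ) : Prop := ∃ r, SAtom.rel r x y ∈ Γ

/-- Γ forms a (directed) tree. -/
def FormsTree (Γ : Finset SAtom) : Prop :=
  Γ = ∅ ∨ ∃ root ∈ labSetF Γ,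
    (∀ x ∈ labSetF Γ, Relation.ReflTransGen (edgeRel ↑Γ) root x) ∧
    (∀ y, ¬ edgeRel ↑Γ y root) ∧
    (∀ x y y', edgeRel ↑Γ y x → edgeRel ↑Γ y' x → y = y')

/-- Γ ⊢ Δ is a sequent. -/
def IsSequent (Γ : Finset SAtom) (Δ : Multiset LC) : Prop :=
  FormsTree Γ ∧
  (Γ ≠ ∅ → ∀ p ∈ Δ, p.1 ∈ labSetF Γ) ∧
  (Γ = ∅ → ∃ x, Δlabels Δ = {x})

/-- y : O̅, the multiset of labeled concepts y : ¬̇C for the GCIs ⊤ ⊑ C of O. -/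
def obar (O : Ontology) (y : ℕ) : Multiset LC := O.gcis.val.map (fun C => (y, nnfNeg C))

/-- x : O̅ for every label x in a given finite set of labels. -/
def obarFor (O : Ontology) (ls : Finset ℕ) : Multiset LC := ls.val.bind (obar O)

/-- y is fresh, i.e. does not occur in the sequent Γ ⊢ Δ. -/
def FreshLabel (y : ℕ) (Γ : Finset SAtom) (Δ : Multiset LC) : Prop :=
  y ∉ labSetF Γ ∧ ∀ p ∈ Δ, p.1 ≠ y

/-- The set {yᵢ ≠̇ yⱼ | i < j}. -/
def neqSet {n : ℕ} (ys : Fin n → ℕ) : Finset SAtom :=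
  ((Finset.univ : Finset (Fin n × Fin n)).filter (fun p => p.1 < p.2)).image
    (fun p => SAtom.neq (ys p.1) (ys p.2))

/-- The set {r(x, yᵢ) | i}. -/
def relSet {n : ℕ} (r : Role) (x : ℕ) (ys : Fin n → ℕ) : Finset SAtom :=
  (Finset.univ : Finset (Fin n)).image (fun i => SAtom.rel r x (ys i))

/-- The multiset y₀ : ¬̇C, y₀ : O̅, …, yₙ : ¬̇C, yₙ : O̅. -/
def leΔ (O : Ontology) (C : Concept) {n : ℕ} (ys : Fin n → ℕ) : Multiset LC :=
  ∑ i : Fin n, ((ys i, nnfNeg C) ::ₘ obar O (ys i))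

/-- The sequent calculus S(O): `Deriv O Γ Δ n` states that the sequent Γ ⊢ Δ has
a proof in S(O) of height at most n. -/
inductive Deriv (O : Ontology) : Finset SAtom → Multiset LC → ℕ → Prop
  | id (Γ : Finset SAtom) (Δ : Multiset LC) (x A : ℕ) (n : ℕ) :
      Deriv O Γ ((x, Concept.atom A) ::ₘ (x, Concept.nneg A) ::ₘ Δ) n
  | idEq (Γ : Finset SAtom) (Δ : Multiset LC) (x y : ℕ) (n : ℕ)
      (hmem : SAtom.neq x y ∈ Γ) (h : eqRel ↑Γ x y) :
      Deriv O Γ Δ n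
  | subst (Γ : Finset SAtom) (Δ : Multiset LC) (x y : ℕ) (L : Concept) (n : ℕ)
      (hL : IsLiteral L) (h : eqRel ↑Γ x y)
      (p : Deriv O Γ ((x, L) ::ₘ (y, L) ::ₘ Δ) n) :
      Deriv O Γ ((x, L) ::ₘ Δ) (n + 1)
  | orR (Γ : Finset SAtom) (Δ : Multiset LC) (x : ℕ) (C D : Concept) (n : ℕ)
      (p : Deriv O Γ ((x, C) ::ₘ (x, D) ::ₘ Δ) n) :
      Deriv O Γ ((x, Concept.union C D) ::ₘ Δ) (n + 1)
  | andR (Γ : Finset SAtom) (Δ : Multiset LC) (x : ℕ) (C D : Concept) (n : ℕ)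
      (p : Deriv O Γ ((x, C) ::ₘ Δ) n) (q : Deriv O Γ ((x, D) ::ₘ Δ) n) :
      Deriv O Γ ((x, Concept.inter C D) ::ₘ Δ) (n + 1)
  | exR (Γ : Finset SAtom) (Δ : Multiset LC) (x y : ℕ) (r : Role) (C : Concept) (n : ℕ)
      (h : pgLang ↑Γ O r x y)
      (p : Deriv O Γ ((x, Concept.ex r C) ::ₘ (y, C) ::ₘ Δ) n) :
      Deriv O Γ ((x, Concept.ex r C) ::ₘ Δ) (n + 1)
  | allR (Γ : Finset SAtom) (Δ : Multiset LC) (x y : ℕ) (r : Role) (C : Concept) (n : ℕ)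
      (hy : FreshLabel y Γ ((x, Concept.all r C) ::ₘ Δ))
      (p : Deriv O (insert (SAtom.rel r x y) Γ) ((y, C) ::ₘ (obar O y + Δ)) n) :
      Deriv O Γ ((x, Concept.all r C) ::ₘ Δ) (n + 1)
  | leR (Γ : Finset SAtom) (Δ : Multiset LC) (x : ℕ) (r : Role) (C : Concept)
      (k : ℕ) (n : ℕ) (ys : Fin (k + 1) → ℕ)
      (hinj : Function.Injective ys)
      (hfresh : ∀ i, FreshLabel (ys i) Γ ((x, Concept.atMost k r C) ::ₘ Δ))
      (p : Deriv O (Γ ∪ neqSet ys ∪ relSet r x ys) (leΔ O C ys + Δ) n) :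
      Deriv O Γ ((x, Concept.atMost k r C) ::ₘ Δ) (n + 1)
  | geR (Γ : Finset SAtom) (Δ : Multiset LC) (x : ℕ) (r : Role) (C : Concept)
      (k : ℕ) (n : ℕ) (ys : Fin k → ℕ)
      (hpath : ∀ i, pgLang ↑Γ O r x (ys i))
      (p : ∀ i, Deriv O Γ ((ys i, C) ::ₘ (x, Concept.atLeast k r C) ::ₘ Δ) n)
      (q : ∀ i j : Fin k, i < j →
        Deriv O (insert (SAtom.eq (ys i) (ys j)) Γ) ((x, Concept.atLeast k r C) ::ₘ Δ) n) :
      Deriv O Γ ((x, Concept.atLeast k r C) ::ₘ Δ) (n + 1)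

/-- S(O) ⊩ Γ ⊢ Δ. -/
def SProvable (O : Ontology) (Γ : Finset SAtom) (Δ : Multiset LC) : Prop := ∃ n, Deriv O Γ Δ n

/-- Satisfaction of a structural atom under a label assignment. -/
def satAtom {δ : Type} (I : Interp δ) (lam : ℕ → δ) : SAtom → Prop
  | .rel r x y => (lam x, lam y) ∈ I.roleI r
  | .eq x y => lam x = lam y
  | .neq x y => lam x ≠ lam y

/-- I, λ ⊨^∀ Γ. -/
def satAll {δ : Type} (I : Interp δ) (lam : ℕ → δ) (Γ : Set SAtom) : Prop :=
  ∀ a ∈ Γ, satAtom I lam a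

/-- I, λ ⊨^∃ Δ. -/
def satEx {δ : Type} (I : Interp δ) (lam : ℕ → δ) (Δ : Multiset LC) : Prop :=
  ∃ p ∈ Δ, lam p.1 ∈ I.cInterp p.2

/-- ⊨_O Γ ⊢ Δ : validity of a sequent relative to O. -/
def ValidSeq (O : Ontology) (Γ : Finset SAtom) (Δ : Multiset LC) : Prop :=
  ∀ (δ : Type) [Nonempty δ] (I : Interp δ) (lam : ℕ → δ),
    I.models O → satAll I lam ↑Γ → satEx I lam Δ

/-- Label substitution (x/y) on labels: replace y by x. -/
def substLab (x y z : ℕ) : ℕ := if z = y then x else z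

/-- Label substitution (x/y) on structural atoms. -/
def SAtom.substL (x y : ℕ) : SAtom → SAtom
  | .rel r a b => .rel r (substLab x y a) (substLab x y b)
  | .eq a b => .eq (substLab x y a) (substLab x y b)
  | .neq a b => .neq (substLab x y a) (substLab x y b)

/-- Label substitution (x/y) on the antecedent. -/
def substΓ (x y : ℕ) (Γ : Finset SAtom) : Finset SAtom := Γ.image (SAtom.substL x y)

/-- Label substitution (x/y) on the consequent. -/
def substΔ (x y : ℕ) (Δ : Multiset LC) : Multiset LC := Δ.map (fun p => (substLab x y p.1, p.2))

/-- Exactly one of three propositions holds. -/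
def XOr3 (a b c : Prop) : Prop := (a ∧ ¬b ∧ ¬c) ∨ (¬a ∧ b ∧ ¬c) ∨ (¬a ∧ ¬b ∧ c)

/-- A member Γᵢ ⊢ Δᵢ of an interpolant. -/
abbrev ISeq := (Finset SAtom) × (Finset LC)

/-- 𝒢 is an interpolant: every member's antecedent consists of equality and
inequality atoms between distinct labels. -/
def IsInterpolant (G : Finset ISeq) : Prop :=
  ∀ p ∈ G, ∀ a ∈ p.1, ∃ x y : ℕ, x ≠ y ∧ (a = SAtom.eq x y ∨ a = SAtom.neq x y)

/-- The orthogonality condition between a member p of 𝒢 and a candidate q. -/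
def orthCond (p q : ISeq) : Prop :=
  XOr3 (∃ x y, SAtom.eq x y ∈ q.1 ∧ SAtom.neq x y ∈ p.1)
       (∃ x y, SAtom.neq x y ∈ q.1 ∧ SAtom.eq x y ∈ p.1)
       (∃ x C, (x, nnfNeg C) ∈ q.2 ∧ (x, C) ∈ p.2)

/-- The orthogonal 𝒢^⊥. -/
def OrthP (G : Set ISeq) : Set ISeq := {q | ∀ p ∈ G, orthCond p q}

/-- Labels occurring in a member of an interpolant. -/
def iseqLabels (p : ISeq) : Finset ℕ := labSetF p.1 ∪ p.2.image Prod.fst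

/-- Concept names occurring in a multiset of labeled concepts. -/
def ΔcnamesS (Δ : Multiset LC) : Set ℕ := {A | ∃ p ∈ Δ, A ∈ cnames p.2}

/-- Disjunction of a list of concepts. -/
def bigUnionL : List Concept → Concept
  | [] => botC
  | [C] => C
  | C :: D :: L => .union C (bigUnionL (D :: L))

/-- Conjunction of a list of concepts. -/
def bigInterL : List Concept → Concept
  | [] => topC
  | [C] => C
  | C :: D :: L => .inter C (bigInterL (D :: L))

/-- ⊓⊔𝒢 : the conjunction of the disjunctions of the members of 𝒢. -/
def interUnion (G : List (List Concept)) : Concept := bigInterL (G.map bigUnionL)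

/-- The interpolant {(⊢ x : C_{i,1}, …, x : C_{i,k_i}) | 1 ≤ i ≤ n}, as a set of ISeqs. -/
def simpleG (x : ℕ) (G : List (List Concept)) : Set ISeq :=
  {p | ∃ S ∈ G, p = (∅, (S.map (fun C => (x, C))).toFinset)}

/-- Renaming of concept names in a concept. -/
def renameC (ρ : ℕ → ℕ) : Concept → Concept
  | .atom A => .atom (ρ A)
  | .nneg A => .nneg (ρ A)
  | .inter C D => .inter (renameC ρ C) (renameC ρ D)
  | .union C D => .union (renameC ρ C) (renameC ρ D)
  | .ex r C => .ex r (renameC ρ C)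
  | .all r C => .all r (renameC ρ C)
  | .atMost n r C => .atMost n r (renameC ρ C)
  | .atLeast n r C => .atLeast n r (renameC ρ C)

/-- Renaming of concept names in an ontology. -/
def renameO (ρ : ℕ → ℕ) (O : Ontology) : Ontology := ⟨O.rias, O.gcis.image (renameC ρ)⟩

/-- C is implicitly concept-definable from Θ under O. -/
def ImplicitlyDefinable (C : Concept) (O : Ontology) (Θ : Finset ℕ) : Prop :=
  ∀ (δ : Type) [Nonempty δ] (I J : Interp δ), I.models O → J.models O →
    (∀ r, I.rI r = J.rI r) → (∀ A ∈ Θ, I.cI A = J.cI A) →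
    I.cInterp C = J.cInterp C

/-- C is explicitly concept-definable from Θ under O. -/
def ExplicitlyDefinable (C : Concept) (O : Ontology) (Θ : Finset ℕ) : Prop :=
  ∃ D : Concept, cnames D ⊆ Θ ∧ entails O C D ∧ entails O D C

/-- RIQ has the concept interpolation property. -/
def ConceptInterpolationProperty : Prop :=
  ∀ (O₁ O₂ : Ontology) (C D : Concept), entails (O₁.union O₂) C D →
    ∃ I : Concept, cnames I ⊆ (cnames C ∪ O₁.cnames) ∩ (cnames D ∪ O₂.cnames) ∧
      entails (O₁.union O₂) C I ∧ entails (O₁.union O₂) I D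

/-- RIQ has the concept-based Beth definability property. -/
def CBP : Prop :=
  ∀ (C : Concept) (O : Ontology) (Θ : Finset ℕ), Θ ⊆ cnames C ∪ O.cnames →
    ImplicitlyDefinable C O Θ → ExplicitlyDefinable C O Θ

/-! ### Soundness -/

theorem Role.invert_invert (r : Role) : r.invert.invert = r := by cases r <;> rfl

namespace Interp

variable {δ : Type} (I : Interp δ)

theorem cInterp_topC : I.cInterp topC = Set.univ := Set.union_compl_self _

theorem cInterp_nnfNeg (C : Concept) : I.cInterp (nnfNeg C) = (I.cInterp C)ᶜ := by
  induction C with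
  | atom A => rfl
  | nneg A => simp [nnfNeg, cInterp]
  | inter C D hC hD => simp [nnfNeg, cInterp, hC, hD, Set.compl_inter]
  | union C D hC hD => simp [nnfNeg, cInterp, hC, hD, Set.compl_union]
  | ex r C hC => ext a; simp [nnfNeg, cInterp, hC]
  | all r C hC => ext a; simp [nnfNeg, cInterp, hC]
  | atMost n r C hC =>
    ext a
    simp [nnfNeg, cInterp, ENat.add_one_le_iff (ENat.natCast_ne_top n)]
  | atLeast n r C hC =>
    cases n with
    | zero => ext a; simp [nnfNeg, cInterp, botC]
    | succ n =>
      ext a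
      simp [nnfNeg, cInterp, ENat.add_one_le_iff (ENat.natCast_ne_top n)]

theorem mem_cInterp_nnfNeg {C : Concept} {a : δ} :
    a ∈ I.cInterp (nnfNeg C) ↔ a ∉ I.cInterp C := by
  rw [cInterp_nnfNeg]; rfl

theorem roleI_invert {r : Role} {a b : δ} : (a, b) ∈ I.roleI r.invert ↔ (b, a) ∈ I.roleI r := by
  cases r <;> rfl

theorem listComp_append {S T : List Role} {a c : δ} :
    (a, c) ∈ I.listComp (S ++ T) ↔ ∃ b, (a, b) ∈ I.listComp S ∧ (b, c) ∈ I.listComp T := by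
  induction S generalizing a with
  | nil => simp [listComp]
  | cons r S ih =>
    simp only [List.cons_append, listComp, Set.mem_ofPred_eq, ih]
    constructor
    · rintro ⟨b, hb, d, hd, h⟩
      exact ⟨d, ⟨b, hb, hd⟩, h⟩
    · rintro ⟨d, ⟨b, hb, hd⟩, h⟩
      exact ⟨b, hb, d, hd, h⟩

theorem listComp_singleton {r : Role} : I.listComp [r] = I.roleI r := by
  ext ⟨a, b⟩
  simp [listComp]

theorem listComp_reverse {T : List Role} {a b : δ} :
    (a, b) ∈ I.listComp (T.map Role.invert).reverse ↔ (b, a) ∈ I.listComp T := by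
  induction T generalizing b with
  | nil => simp [listComp, eq_comm]
  | cons r T ih =>
    rw [List.map_cons, List.reverse_cons, listComp_append, listComp_singleton]
    simp only [listComp, Set.mem_ofPred_eq, ih, roleI_invert]
    exact exists_congr fun c => and_comm

variable {I} {O : Ontology}

theorem models.listComp_subset_of_prodRule (hI : I.models O) {s : Role} {T : List Role}
    (h : ProdRule O s T) : I.listComp T ⊆ I.roleI s := by
  obtain ⟨ria, hr, ⟨rfl, rfl⟩ | ⟨rfl, rfl⟩⟩ := h
  · exact hI.2 ria hr
  · rintro ⟨a, b⟩ hab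
    exact I.roleI_invert.2 (hI.2 ria hr (I.listComp_reverse.1 hab))

theorem models.listComp_subset_of_oneStep (hI : I.models O) {S T : List Role}
    (h : OneStep O S T) : I.listComp T ⊆ I.listComp S := by
  obtain ⟨S', s, T', R', hp, rfl, rfl⟩ := h
  rintro ⟨a, d⟩ had
  obtain ⟨c, hac, hcd⟩ := I.listComp_append.1 had
  obtain ⟨b, hab, hbc⟩ := I.listComp_append.1 hac
  exact I.listComp_append.2 ⟨b, hab, c, hI.listComp_subset_of_prodRule hp hbc, hcd⟩

theorem models.listComp_subset_of_mem_lang (hI : I.models O) {r : Role} {S : List Role}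
    (h : S ∈ lang O r) : I.listComp S ⊆ I.roleI r := by
  change Relation.ReflTransGen _ _ _ at h
  induction h with
  | refl => rw [listComp_singleton]
  | tail _ hs ih => exact (hI.listComp_subset_of_oneStep hs).trans ih

theorem models.not_mem_obar (hI : I.models O) {lam : ℕ → δ} {y : ℕ} {p : LC}
    (hp : p ∈ obar O y) : lam p.1 ∉ I.cInterp p.2 := by
  obtain ⟨C, hC, rfl⟩ := Multiset.mem_map.1 hp
  rw [mem_cInterp_nnfNeg, not_not]
  exact hI.1 C hC (by rw [cInterp_topC]; trivial)

end Interp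

section Satisfaction

variable {δ : Type} {I : Interp δ} {lam : ℕ → δ} {Γ : Set SAtom}

theorem satAll.eq_of_eqRel (h : satAll I lam Γ) {x y : ℕ} (hxy : eqRel Γ x y) :
    lam x = lam y := by
  induction hxy with
  | refl => rfl
  | tail _ hs ih =>
    rw [ih]
    rcases hs with hs | hs
    · exact h _ hs
    · exact (h _ hs).symm

theorem satAll.mem_listComp_of_pgPath (h : satAll I lam Γ) {S : List Role} {x y : ℕ}
    (hxy : pgPath Γ S x y) : (lam x, lam y) ∈ I.listComp S := by
  induction S generalizing x with
  | nil => exact h.eq_of_eqRel hxy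
  | cons r S ih =>
    obtain ⟨z, hz, hzy⟩ := hxy
    refine ⟨lam z, ?_, ih hzy⟩
    rcases hz with ⟨u, v, hu, hv, huv⟩ | ⟨u, v, hu, hv, huv⟩
    · rw [h.eq_of_eqRel hu, h.eq_of_eqRel hv]
      exact h _ huv
    · rw [h.eq_of_eqRel hu, h.eq_of_eqRel hv]
      exact I.roleI_invert.1 (h _ huv)

theorem satAll.mem_roleI_of_pgLang (h : satAll I lam Γ) {O : Ontology} (hI : I.models O)
    {r : Role} {x y : ℕ} (hxy : pgLang Γ O r x y) : (lam x, lam y) ∈ I.roleI r :=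
  let ⟨_, hS, hp⟩ := hxy
  hI.listComp_subset_of_mem_lang hS (h.mem_listComp_of_pgPath hp)

theorem satEx_cons {p : LC} {Δ : Multiset LC} :
    satEx I lam (p ::ₘ Δ) ↔ lam p.1 ∈ I.cInterp p.2 ∨ satEx I lam Δ := by
  simp [satEx]

theorem satEx_add {Δ₁ Δ₂ : Multiset LC} :
    satEx I lam (Δ₁ + Δ₂) ↔ satEx I lam Δ₁ ∨ satEx I lam Δ₂ := by
  simp only [satEx, Multiset.mem_add, or_and_right, exists_or]

theorem Interp.models.not_satEx_obar {O : Ontology} (hI : I.models O) {y : ℕ} :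
    ¬ satEx I lam (obar O y) :=
  fun ⟨_, hp, h⟩ => hI.not_mem_obar hp h

theorem satAtom_congr {lam' : ℕ → δ} {a : SAtom} (h : ∀ z ∈ a.labels, lam' z = lam z)
    (ha : satAtom I lam a) : satAtom I lam' a := by
  cases a <;> simp_all [SAtom.labels, satAtom]

theorem satAll_congr {lam' : ℕ → δ} {G : Finset SAtom} (h : ∀ z ∈ labSetF G, lam' z = lam z)
    (hG : satAll I lam (G : Set SAtom)) : satAll I lam' (G : Set SAtom) := fun a ha =>
  satAtom_congr (fun z hz => h z (Finset.mem_biUnion.2 ⟨a, ha, hz⟩)) (hG a ha)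

theorem satEx_congr {lam' : ℕ → δ} {Δ : Multiset LC} (h : ∀ p ∈ Δ, lam' p.1 = lam p.1)
    (hΔ : satEx I lam' Δ) : satEx I lam Δ := by
  obtain ⟨p, hp, hs⟩ := hΔ
  exact ⟨p, hp, h p hp ▸ hs⟩

end Satisfaction

theorem mem_leΔ {O : Ontology} {C : Concept} {n : ℕ} {ys : Fin n → ℕ} {p : LC} :
    p ∈ leΔ O C ys ↔ ∃ i, p = (ys i, nnfNeg C) ∨ p ∈ obar O (ys i) := by
  simp [leΔ, Multiset.mem_sum]

/-- A set has at least `n` elements iff it contains an injective `n`-tuple. -/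
theorem coe_le_encard_iff {α : Type*} {s : Set α} {n : ℕ} :
    (n : ℕ∞) ≤ s.encard ↔ ∃ f : Fin n → α, Function.Injective f ∧ ∀ i, f i ∈ s := by
  constructor
  · intro h
    obtain ⟨t, hts, ht⟩ := Set.exists_subset_encard_eq h
    have hfin : t.Finite := Set.finite_of_encard_eq_coe ht
    have hcard : hfin.toFinset.card = n := by
      rw [hfin.encard_eq_coe_toFinset_card] at ht
      exact_mod_cast ht
    refine ⟨fun i => ((hfin.toFinset.equivFinOfCardEq hcard).symm i : α), ?_, fun i => ?_⟩
    · exact Subtype.val_injective.comp (Equiv.injective _)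
    · exact hts (hfin.mem_toFinset.1 ((hfin.toFinset.equivFinOfCardEq hcard).symm i).2)
  · rintro ⟨f, hf, hs⟩
    calc (n : ℕ∞) = (Set.range f).encard := by
          rw [← Set.image_univ, hf.encard_image, Set.encard_univ]; simp
      _ ≤ s.encard := Set.encard_le_encard (Set.range_subset_iff.2 hs)

theorem Deriv.validSeq {O : Ontology} {Γ : Finset SAtom} {Δ : Multiset LC} {n : ℕ}
    (h : Deriv O Γ Δ n) : ValidSeq O Γ Δ := by
  induction h with
  | id Γ Δ x A n =>
    intro δ _ I lam _ _
    simp only [satEx_cons]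
    by_cases hx : lam x ∈ I.cInterp (.atom A)
    · exact .inl hx
    · exact .inr (.inl hx)
  | idEq Γ Δ x y n hmem h =>
    intro δ _ I lam _ hΓ
    exact absurd (hΓ.eq_of_eqRel h) (hΓ _ hmem)
  | subst Γ Δ x y L n hL h p ih =>
    intro δ _ I lam hI hΓ
    have := ih δ I lam hI hΓ
    simp only [satEx_cons, ← hΓ.eq_of_eqRel h] at this ⊢
    tauto
  | orR Γ Δ x C D n p ih =>
    intro δ _ I lam hI hΓ
    have := ih δ I lam hI hΓ
    simp only [satEx_cons, Interp.cInterp, Set.mem_union] at this ⊢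
    tauto
  | andR Γ Δ x C D n p q ihp ihq =>
    intro δ _ I lam hI hΓ
    have h₁ := ihp δ I lam hI hΓ
    have h₂ := ihq δ I lam hI hΓ
    simp only [satEx_cons, Interp.cInterp, Set.mem_inter_iff] at h₁ h₂ ⊢
    tauto
  | exR Γ Δ x y r C n h p ih =>
    intro δ _ I lam hI hΓ
    have := ih δ I lam hI hΓ
    rw [satEx_cons, satEx_cons] at this
    rw [satEx_cons]
    rcases this with h' | h' | h'
    · exact .inl h'
    · exact .inl ⟨lam y, hΓ.mem_roleI_of_pgLang hI h, h'⟩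
    · exact .inr h'
  | allR Γ Δ x y r C n hy p ih =>
    intro δ _ I lam hI hΓ
    rw [satEx_cons, or_iff_not_imp_right]
    intro hΔ b hb
    have hx : x ≠ y := hy.2 (x, _) (Multiset.mem_cons_self _ _)
    have hne : ∀ z, z ≠ y → Function.update lam y b z = lam z :=
      fun z hz => Function.update_of_ne hz _ _
    have := ih δ I (Function.update lam y b) hI ?_
    · rw [satEx_cons, satEx_add] at this
      rcases this with h' | h' | h'
      · simpa using h'
      · exact absurd h' hI.not_satEx_obar
      · exact absurd (satEx_congr
          (fun p hp => hne _ (hy.2 p (Multiset.mem_cons_of_mem hp))) h') hΔ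
    · intro a ha
      rw [Finset.coe_insert] at ha
      rcases ha with rfl | ha
      · simpa [satAtom, hne x hx] using hb
      · exact satAll_congr (fun z hz => hne z (fun e => hy.1 (e ▸ hz))) hΓ a ha
  | leR Γ Δ x r C k n ys hinj hfresh p ih =>
    intro δ _ I lam hI hΓ
    rw [satEx_cons, or_iff_not_imp_right]
    intro hΔ
    by_contra hle
    have hk : ((k + 1 : ℕ) : ℕ∞) ≤ {b | (lam x, b) ∈ I.roleI r ∧ b ∈ I.cInterp C}.encard := by
      push_cast
      exact (ENat.add_one_le_iff (ENat.natCast_ne_top k)).2 (not_le.1 hle)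
    obtain ⟨f, hf, hfs⟩ := coe_le_encard_iff.1 hk
    set lam' : ℕ → δ := Function.extend ys f lam with hlam'
    have hys : ∀ i, lam' (ys i) = f i := fun i => hinj.extend_apply f lam i
    have hne : ∀ z, (∀ i, z ≠ ys i) → lam' z = lam z := fun z hz =>
      Function.extend_apply' f lam z (fun ⟨i, hi⟩ => hz i hi.symm)
    have hx : lam' x = lam x :=
      hne x fun i => (hfresh i).2 (x, _) (Multiset.mem_cons_self _ _)
    have := ih δ I lam' hI ?_
    · rcases satEx_add.1 this with ⟨p, hp, hs⟩ | h'
      · obtain ⟨i, rfl | hp⟩ := mem_leΔ.1 hp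
        · rw [hys, I.mem_cInterp_nnfNeg] at hs
          exact hs (hfs i).2
        · exact hI.not_mem_obar hp hs
      · exact hΔ (satEx_congr
          (fun p hp => hne _ fun i => (hfresh i).2 p (Multiset.mem_cons_of_mem hp)) h')
    · intro a ha
      rw [Finset.mem_coe, Finset.mem_union, Finset.mem_union] at ha
      rcases ha with (ha | ha) | ha
      · exact satAll_congr (fun z hz => hne z fun i e => (hfresh i).1 (e ▸ hz)) hΓ a ha
      · simp only [neqSet, Finset.mem_image, Finset.mem_filter, Finset.mem_univ, true_and] at ha
        obtain ⟨⟨i, j⟩, hij, rfl⟩ := ha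
        simpa only [satAtom, hys] using hf.ne hij.ne
      · simp only [relSet, Finset.mem_image, Finset.mem_univ, true_and] at ha
        obtain ⟨i, rfl⟩ := ha
        simpa only [satAtom, hys, hx] using (hfs i).1
  | geR Γ Δ x r C k n ys hpath p q ihp ihq =>
    intro δ _ I lam hI hΓ
    rw [satEx_cons, or_iff_not_imp_right]
    intro hΔ
    by_contra hge
    refine hge (coe_le_encard_iff.2 ⟨lam ∘ ys, ?_, fun i => ⟨?_, ?_⟩⟩)
    · have key : ∀ i j, i < j → lam (ys i) ≠ lam (ys j) := by
        intro i j hij e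
        have := ihq i j hij δ I lam hI (by
          intro a ha
          rw [Finset.coe_insert] at ha
          rcases ha with rfl | ha
          · exact e
          · exact hΓ a ha)
        rw [satEx_cons] at this
        tauto
      intro i j e
      by_contra hij
      rcases lt_or_gt_of_ne hij with h | h
      · exact key i j h e
      · exact key j i h e.symm
    · exact hΓ.mem_roleI_of_pgLang hI (hpath i)
    · have := ihp i δ I lam hI hΓ
      rw [satEx_cons, satEx_cons] at this
      rcases this with h | h | h
      · exact h
      · exact absurd h hge
      · exact absurd h hΔ

/-! ### The R-system and the propagation graph -/

section Grammar

variable {O : Ontology}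

theorem ProdRule.reverse {s : Role} {T : List Role} (h : ProdRule O s T) :
    ProdRule O s.invert (T.map Role.invert).reverse := by
  obtain ⟨ria, hr, ⟨rfl, rfl⟩ | ⟨rfl, rfl⟩⟩ := h
  · exact ⟨ria, hr, .inr ⟨rfl, rfl⟩⟩
  · refine ⟨ria, hr, .inl ⟨Role.invert_invert _, ?_⟩⟩
    simp [List.map_reverse, Function.comp_def, Role.invert_invert]

theorem OneStep.reverse {S T : List Role} (h : OneStep O S T) :
    OneStep O (S.map Role.invert).reverse (T.map Role.invert).reverse := by
  obtain ⟨S', s, T', R', hp, rfl, rfl⟩ := h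
  exact ⟨(R'.map Role.invert).reverse, s.invert, _, (S'.map Role.invert).reverse,
    hp.reverse, by simp, by simp⟩

theorem lang_reverse {r : Role} {S : List Role} (h : S ∈ lang O r) :
    (S.map Role.invert).reverse ∈ lang O r.invert :=
  Relation.ReflTransGen.lift (fun S : List Role => (S.map Role.invert).reverse)
    (fun _ _ => OneStep.reverse) _ _ h

theorem OneStep.append {S T : List Role} (h : OneStep O S T) (P Q : List Role) :
    OneStep O (P ++ S ++ Q) (P ++ T ++ Q) := by
  obtain ⟨S', s, T', R', hp, rfl, rfl⟩ := h
  exact ⟨P ++ S', s, T', R' ++ Q, hp, by simp, by simp⟩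

theorem derives_append {S T S' T' : List Role} (h : Relation.ReflTransGen (OneStep O) S T)
    (h' : Relation.ReflTransGen (OneStep O) S' T') :
    Relation.ReflTransGen (OneStep O) (S ++ S') (T ++ T') := by
  have h₁ : Relation.ReflTransGen (OneStep O) (S ++ S') (T ++ S') :=
    Relation.ReflTransGen.lift (· ++ S') (fun _ _ hs => by simpa using hs.append [] S') _ _ h
  have h₂ : Relation.ReflTransGen (OneStep O) (T ++ S') (T ++ T') :=
    Relation.ReflTransGen.lift (T ++ ·) (fun _ _ hs => by simpa using hs.append T []) _ _ h'
  exact h₁.trans h₂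

theorem ProdRule.oneStep {s : Role} {T : List Role} (h : ProdRule O s T) : OneStep O [s] T :=
  ⟨[], s, T, [], h, rfl, by simp⟩

end Grammar

section PropagationGraph

variable {Γ Γ' : Set SAtom} {O : Ontology}

theorem eqRel_equivalence (Γ : Set SAtom) : Equivalence (eqRel Γ) where
  refl _ := .refl
  symm h := by
    induction h with
    | refl => exact .refl
    | tail _ hs ih => exact .head (Or.symm hs) ih
  trans := .trans

theorem eqRel.symm {x y : ℕ} (h : eqRel Γ x y) : eqRel Γ y x := (eqRel_equivalence Γ).symm h

theorem eqRel.mono (hΓ : Γ ⊆ Γ') {x y : ℕ} (h : eqRel Γ x y) : eqRel Γ' x y :=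
  Relation.ReflTransGen.mono (fun _ _ => Or.imp (@hΓ _) (@hΓ _)) _ _ h

theorem pgEdge.mono (hΓ : Γ ⊆ Γ') {x y : ℕ} {r : Role} (h : pgEdge Γ x r y) :
    pgEdge Γ' x r y := by
  rcases h with ⟨z, w, hz, hw, h⟩ | ⟨z, w, hz, hw, h⟩
  · exact .inl ⟨z, w, hz.mono hΓ, hw.mono hΓ, hΓ h⟩
  · exact .inr ⟨z, w, hz.mono hΓ, hw.mono hΓ, hΓ h⟩

theorem pgPath.mono (hΓ : Γ ⊆ Γ') {S : List Role} {x y : ℕ} (h : pgPath Γ S x y) :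
    pgPath Γ' S x y := by
  induction S generalizing x with
  | nil => exact eqRel.mono hΓ h
  | cons r S ih =>
    obtain ⟨z, hz, h⟩ := h
    exact ⟨z, hz.mono hΓ, ih h⟩

theorem pgLang.mono (hΓ : Γ ⊆ Γ') {r : Role} {x y : ℕ} (h : pgLang Γ O r x y) :
    pgLang Γ' O r x y :=
  let ⟨S, hS, hp⟩ := h
  ⟨S, hS, hp.mono hΓ⟩

theorem pgEdge.congr {x x' y y' : ℕ} {r : Role} (hx : eqRel Γ x x') (hy : eqRel Γ y y')
    (h : pgEdge Γ x r y) : pgEdge Γ x' r y' := by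
  rcases h with ⟨z, w, hz, hw, h⟩ | ⟨z, w, hz, hw, h⟩
  · exact .inl ⟨z, w, hx.symm.trans hz, hy.symm.trans hw, h⟩
  · exact .inr ⟨z, w, hy.symm.trans hz, hx.symm.trans hw, h⟩

theorem pgPath.congr {x x' y y' : ℕ} {S : List Role} (hx : eqRel Γ x x') (hy : eqRel Γ y y')
    (h : pgPath Γ S x y) : pgPath Γ S x' y' := by
  induction S generalizing x x' with
  | nil => exact (hx.symm.trans h).trans hy
  | cons r S ih =>
    obtain ⟨z, hz, h⟩ := h
    exact ⟨z, hz.congr hx .refl, ih .refl h⟩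

theorem pgLang.congr {x x' y y' : ℕ} {r : Role} (hx : eqRel Γ x x') (hy : eqRel Γ y y')
    (h : pgLang Γ O r x y) : pgLang Γ O r x' y' :=
  let ⟨S, hS, hp⟩ := h
  ⟨S, hS, hp.congr hx hy⟩

theorem pgPath.append {S T : List Role} {x y z : ℕ} (h : pgPath Γ S x y)
    (h' : pgPath Γ T y z) : pgPath Γ (S ++ T) x z := by
  induction S generalizing x with
  | nil => exact h'.congr (eqRel.symm h) .refl
  | cons r S ih =>
    obtain ⟨w, hw, h⟩ := h
    exact ⟨w, hw, ih h⟩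

theorem pgEdge.invert {x y : ℕ} {r : Role} (h : pgEdge Γ x r y) : pgEdge Γ y r.invert x := by
  rcases h with ⟨z, w, hz, hw, h⟩ | ⟨z, w, hz, hw, h⟩
  · exact .inr ⟨z, w, hz, hw, by rwa [Role.invert_invert]⟩
  · exact .inl ⟨z, w, hz, hw, h⟩

theorem pgPath.reverse {S : List Role} {x y : ℕ} (h : pgPath Γ S x y) :
    pgPath Γ (S.map Role.invert).reverse y x := by
  induction S generalizing x with
  | nil => exact eqRel.symm h
  | cons r S ih =>
    obtain ⟨z, hz, h⟩ := h
    rw [List.map_cons, List.reverse_cons]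
    exact (ih h).append ⟨x, hz.invert, .refl⟩

theorem pgLang.reverse {r : Role} {x y : ℕ} (h : pgLang Γ O r x y) :
    pgLang Γ O r.invert y x :=
  let ⟨_, hS, hp⟩ := h
  ⟨_, lang_reverse hS, hp.reverse⟩

theorem pgLang_of_rel {r : Role} {x y : ℕ} (h : SAtom.rel r x y ∈ Γ) : pgLang Γ O r x y :=
  ⟨[r], .refl, y, .inl ⟨x, y, .refl, .refl, h⟩, .refl⟩

end PropagationGraph

section DirectedUnion

variable {G : ℕ → Set SAtom} (hG : Monotone G)
include hG

theorem exists_eqRel_of_iUnion {x y : ℕ} (h : eqRel (⋃ n, G n) x y) : ∃ n, eqRel (G n) x y := by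
  induction h with
  | refl => exact ⟨0, .refl⟩
  | @tail b c _ hs ih =>
    obtain ⟨n, hn⟩ := ih
    obtain ⟨m, hm⟩ : ∃ m, eqStep (G m) b c := by
      rcases hs with hs | hs
      · obtain ⟨m, hm⟩ := Set.mem_iUnion.1 hs
        exact ⟨m, .inl hm⟩
      · obtain ⟨m, hm⟩ := Set.mem_iUnion.1 hs
        exact ⟨m, .inr hm⟩
    exact ⟨max n m, (hn.mono (hG (le_max_left n m))).trans
      (eqRel.mono (hG (le_max_right n m)) (.single hm))⟩

theorem exists_pgEdge_of_iUnion {x y : ℕ} {r : Role} (h : pgEdge (⋃ n, G n) x r y) :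
    ∃ n, pgEdge (G n) x r y := by
  rcases h with ⟨z, w, hz, hw, h⟩ | ⟨z, w, hz, hw, h⟩ <;>
  · obtain ⟨i, hi⟩ := exists_eqRel_of_iUnion hG hz
    obtain ⟨j, hj⟩ := exists_eqRel_of_iUnion hG hw
    obtain ⟨k, hk⟩ := Set.mem_iUnion.1 h
    have hi' := hi.mono (hG (show i ≤ max i (max j k) by simp))
    have hj' := hj.mono (hG (show j ≤ max i (max j k) by simp))
    have hk' := hG (show k ≤ max i (max j k) by simp) hk
    first
      | exact ⟨_, .inl ⟨z, w, hi', hj', hk'⟩⟩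
      | exact ⟨_, .inr ⟨z, w, hi', hj', hk'⟩⟩

theorem exists_pgPath_of_iUnion {x y : ℕ} {S : List Role} (h : pgPath (⋃ n, G n) S x y) :
    ∃ n, pgPath (G n) S x y := by
  induction S generalizing x with
  | nil => exact exists_eqRel_of_iUnion hG h
  | cons r S ih =>
    obtain ⟨z, hz, h⟩ := h
    obtain ⟨i, hi⟩ := exists_pgEdge_of_iUnion hG hz
    obtain ⟨j, hj⟩ := ih h
    exact ⟨max i j, z, hi.mono (hG (le_max_left i j)), hj.mono (hG (le_max_right i j))⟩

theorem exists_pgLang_of_iUnion {O : Ontology} {x y : ℕ} {r : Role}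
    (h : pgLang (⋃ n, G n) O r x y) : ∃ n, pgLang (G n) O r x y := by
  obtain ⟨S, hS, hp⟩ := h
  obtain ⟨n, hn⟩ := exists_pgPath_of_iUnion hG hp
  exact ⟨n, S, hS, hn⟩

end DirectedUnion

/-! ### Hintikka structures and their term models -/

/-- Saturation conditions on a set of active labels, a set of structural atoms and a set of
labeled concepts, as met by the limit of a failed proof search. -/
structure Hintikka (O : Ontology) (V : Set ℕ) (Γ : Set SAtom) (H : Set LC) : Prop where
  gci : ∀ x ∈ V, ∀ C ∈ O.gcis, (x, nnfNeg C) ∈ H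
  clash : ∀ x A, (x, Concept.atom A) ∈ H → (x, Concept.nneg A) ∉ H
  neq : ∀ x y, SAtom.neq x y ∈ Γ → ¬ eqRel Γ x y
  subst : ∀ x A, (x, Concept.atom A) ∈ H → ∀ y ∈ V, eqRel Γ x y → (y, Concept.atom A) ∈ H
  inter : ∀ x C D, (x, Concept.inter C D) ∈ H → (x, C) ∈ H ∨ (x, D) ∈ H
  union : ∀ x C D, (x, Concept.union C D) ∈ H → (x, C) ∈ H ∧ (x, D) ∈ H
  ex : ∀ x r C, (x, Concept.ex r C) ∈ H → ∀ y ∈ V, pgLang Γ O r x y → (y, C) ∈ H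
  all : ∀ x r C, (x, Concept.all r C) ∈ H → ∃ y ∈ V, SAtom.rel r x y ∈ Γ ∧ (y, C) ∈ H
  atMost : ∀ x k r C, (x, Concept.atMost k r C) ∈ H → ∃ ys : Fin (k + 1) → ℕ,
    (∀ i, ys i ∈ V ∧ SAtom.rel r x (ys i) ∈ Γ ∧ (ys i, nnfNeg C) ∈ H) ∧
    ∀ i j, i < j → SAtom.neq (ys i) (ys j) ∈ Γ
  atLeast : ∀ x k r C, (x, Concept.atLeast k r C) ∈ H → ∀ ys : Fin k → ℕ,
    (∀ i, ys i ∈ V ∧ pgLang Γ O r x (ys i)) →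
    (∃ i, (ys i, C) ∈ H) ∨ ∃ i j, i < j ∧ eqRel Γ (ys i) (ys j)

/-- A size measure on concepts that NNF-negation does not increase. -/
def Concept.size : Concept → ℕ
  | .atom _ => 1
  | .nneg _ => 1
  | .inter C D => C.size + D.size + 1
  | .union C D => C.size + D.size + 1
  | .ex _ C => C.size + 1
  | .all _ C => C.size + 1
  | .atMost _ _ C => C.size + 3
  | .atLeast _ _ C => C.size + 3

theorem Concept.size_nnfNeg_le (C : Concept) : (nnfNeg C).size ≤ C.size := by
  induction C with
  | atLeast n r C ih => cases n <;> simp [nnfNeg, Concept.size, botC]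
  | _ => simp_all [nnfNeg, Concept.size, Nat.add_le_add]

section TermModel

variable (O : Ontology) (V : Set ℕ) (Γ : Set SAtom) (H : Set LC)

/-- Active labels up to the equality atoms of `Γ`. -/
def labelSetoid : Setoid V where
  r x y := eqRel Γ x y
  iseqv := ⟨fun _ => .refl, fun h => h.symm, fun h h' => h.trans h'⟩

/-- The domain of the term model: classes of active labels. -/
abbrev TermDomain : Type := Quotient (labelSetoid V Γ)

/-- The term model: roles hold along propagation paths, and concept names hold at the labels
where their negation is to be refuted. -/
def termModel : Interp (TermDomain V Γ) where
  cI A := {a | ∃ x : V, a = Quotient.mk _ x ∧ ((x : ℕ), Concept.nneg A) ∈ H}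
  rI r := {p | ∃ x y : V, p = (Quotient.mk _ x, Quotient.mk _ y) ∧
    pgLang Γ O (.name r) x y}

variable {O V Γ H}

theorem mk_eq_mk_iff {x y : V} :
    (Quotient.mk (labelSetoid V Γ) x = Quotient.mk (labelSetoid V Γ) y) ↔ eqRel Γ x y :=
  Quotient.eq

theorem mem_roleI_termModel {r : Role} {x y : V} :
    ((Quotient.mk _ x, Quotient.mk _ y) ∈ (termModel O V Γ H).roleI r) ↔ pgLang Γ O r x y := by
  have key : ∀ (n : ℕ) (x y : V), ((Quotient.mk _ x, Quotient.mk _ y) ∈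
      (termModel O V Γ H).rI n) ↔ pgLang Γ O (.name n) x y := by
    intro n x y
    constructor
    · rintro ⟨x', y', he, h⟩
      rw [Prod.mk.injEq, mk_eq_mk_iff, mk_eq_mk_iff] at he
      exact h.congr he.1.symm he.2.symm
    · exact fun h => ⟨x, y, rfl, h⟩
  cases r with
  | name n => exact key n x y
  | inv n => exact (key n y x).trans ⟨fun h => h.reverse, fun h => h.reverse⟩

theorem exists_pgPath_of_mem_listComp {T : List Role} {x y : V}
    (h : (Quotient.mk _ x, Quotient.mk _ y) ∈ (termModel O V Γ H).listComp T) :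
    ∃ S, Relation.ReflTransGen (OneStep O) T S ∧ pgPath Γ S x y := by
  induction T generalizing x with
  | nil => exact ⟨[], .refl, mk_eq_mk_iff.1 h⟩
  | cons r T ih =>
    obtain ⟨b, hb, h⟩ := h
    obtain ⟨z, rfl⟩ := Quotient.exists_rep b
    obtain ⟨S, hS, hp⟩ := mem_roleI_termModel.1 hb
    obtain ⟨S', hS', hp'⟩ := ih h
    exact ⟨S ++ S', derives_append hS hS', hp.append hp'⟩

namespace Hintikka

variable (hH : Hintikka O V Γ H)
include hH

/-- Every labeled concept of a Hintikka structure is refuted in its term model. -/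
theorem not_mem_cInterp (C : Concept) (x : V) (hx : ((x : ℕ), C) ∈ H) :
    (Quotient.mk _ x : TermDomain V Γ) ∉ (termModel O V Γ H).cInterp C := by
  match C, hx with
  | .atom A, hx =>
    rintro ⟨y, he, hy⟩
    exact hH.clash y A (hH.subst x A hx y y.2 (mk_eq_mk_iff.1 he)) hy
  | .nneg A, hx => exact fun h => h ⟨x, rfl, hx⟩
  | .inter C D, hx =>
    rintro ⟨hC, hD⟩
    rcases hH.inter x C D hx with h | h
    · exact not_mem_cInterp C x h hC
    · exact not_mem_cInterp D x h hD
  | .union C D, hx =>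
    obtain ⟨hC, hD⟩ := hH.union x C D hx
    rintro (h | h)
    · exact not_mem_cInterp C x hC h
    · exact not_mem_cInterp D x hD h
  | .ex r C, hx =>
    rintro ⟨b, hb, hC⟩
    obtain ⟨y, rfl⟩ := Quotient.exists_rep b
    exact not_mem_cInterp C y (hH.ex x r C hx y y.2 (mem_roleI_termModel.1 hb)) hC
  | .all r C, hx =>
    intro h
    obtain ⟨y, hy, hr, hC⟩ := hH.all x r C hx
    exact not_mem_cInterp C ⟨y, hy⟩ hC
      (h _ (mem_roleI_termModel.2 (pgLang_of_rel hr)))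
  | .atMost k r C, hx =>
    intro h
    obtain ⟨ys, hys, hne⟩ := hH.atMost x k r C hx
    have hle : ((k + 1 : ℕ) : ℕ∞) ≤ (k : ℕ∞) := by
      refine (coe_le_encard_iff.2 ?_).trans h
      refine ⟨fun i => Quotient.mk _ ⟨ys i, (hys i).1⟩, ?_, fun i => ⟨?_, ?_⟩⟩
      · intro i j e
        have e' : eqRel Γ (ys i) (ys j) := mk_eq_mk_iff.1 e
        by_contra hij
        rcases lt_or_gt_of_ne hij with hlt | hlt
        · exact hH.neq _ _ (hne i j hlt) e'
        · exact hH.neq _ _ (hne j i hlt) e'.symm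
      · exact mem_roleI_termModel.2 (pgLang_of_rel (hys i).2.1)
      · have := not_mem_cInterp (nnfNeg C) ⟨ys i, (hys i).1⟩ (hys i).2.2
        rwa [Interp.mem_cInterp_nnfNeg, not_not] at this
    have : k + 1 ≤ k := by exact_mod_cast hle
    omega
  | .atLeast k r C, hx =>
    intro h
    obtain ⟨f, hf, hfs⟩ := coe_le_encard_iff.1 h
    choose ys hys using fun i => Quotient.exists_rep (f i)
    have hpath : ∀ i, pgLang Γ O r x (ys i) := fun i =>
      mem_roleI_termModel.1 (by rw [hys]; exact (hfs i).1)
    rcases hH.atLeast x k r C hx (fun i => ys i) (fun i => ⟨(ys i).2, hpath i⟩) with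
      ⟨i, hi⟩ | ⟨i, j, hij, he⟩
    · exact not_mem_cInterp C (ys i) hi (by rw [hys]; exact (hfs i).2)
    · refine hij.ne (hf ?_)
      rw [← hys i, ← hys j]
      exact mk_eq_mk_iff.2 he
termination_by C.size
decreasing_by
  all_goals have := Concept.size_nnfNeg_le
  all_goals simp only [Concept.size]
  all_goals grind

theorem models_termModel : (termModel O V Γ H).models O := by
  constructor
  · intro C hC a _
    obtain ⟨x, rfl⟩ := Quotient.exists_rep a
    have := hH.not_mem_cInterp _ x (hH.gci x x.2 C hC)
    rwa [Interp.mem_cInterp_nnfNeg, not_not] at this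
  · rintro ria hr ⟨a, b⟩ h
    obtain ⟨x, rfl⟩ := Quotient.exists_rep a
    obtain ⟨y, rfl⟩ := Quotient.exists_rep b
    obtain ⟨S, hS, hp⟩ := exists_pgPath_of_mem_listComp h
    have hstep : OneStep O [ria.rhs] ria.lhs := ProdRule.oneStep ⟨ria, hr, .inl ⟨rfl, rfl⟩⟩
    exact mem_roleI_termModel.2 ⟨S, .head hstep hS, hp⟩

end Hintikka

end TermModel

/-! ### Proof search -/

section Provability

variable {O : Ontology} {Γ : Finset SAtom} {Δ : Multiset LC}

theorem Deriv.mono {n m : ℕ} (h : Deriv O Γ Δ n) (hnm : n ≤ m) : Deriv O Γ Δ m := by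
  induction h generalizing m with
  | id => exact .id ..
  | idEq _ _ x y _ hmem h => exact .idEq _ _ x y _ hmem h
  | subst _ _ x y L _ hL h _ ih =>
    obtain ⟨m, rfl⟩ : ∃ l, m = l + 1 := ⟨m - 1, by omega⟩
    exact .subst _ _ x y L _ hL h (ih (by omega))
  | orR _ _ x C D _ _ ih =>
    obtain ⟨m, rfl⟩ : ∃ l, m = l + 1 := ⟨m - 1, by omega⟩
    exact .orR _ _ x C D _ (ih (by omega))
  | andR _ _ x C D _ _ _ ihp ihq =>
    obtain ⟨m, rfl⟩ : ∃ l, m = l + 1 := ⟨m - 1, by omega⟩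
    exact .andR _ _ x C D _ (ihp (by omega)) (ihq (by omega))
  | exR _ _ x y r C _ h _ ih =>
    obtain ⟨m, rfl⟩ : ∃ l, m = l + 1 := ⟨m - 1, by omega⟩
    exact .exR _ _ x y r C _ h (ih (by omega))
  | allR _ _ x y r C _ hy _ ih =>
    obtain ⟨m, rfl⟩ : ∃ l, m = l + 1 := ⟨m - 1, by omega⟩
    exact .allR _ _ x y r C _ hy (ih (by omega))
  | leR _ _ x r C k _ ys hinj hfresh _ ih =>
    obtain ⟨m, rfl⟩ : ∃ l, m = l + 1 := ⟨m - 1, by omega⟩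
    exact .leR _ _ x r C k _ ys hinj hfresh (ih (by omega))
  | geR _ _ x r C k _ ys hpath _ _ ihp ihq =>
    obtain ⟨m, rfl⟩ : ∃ l, m = l + 1 := ⟨m - 1, by omega⟩
    exact .geR _ _ x r C k _ ys hpath (fun i => ihp i (by omega))
      (fun i j hij => ihq i j hij (by omega))

theorem SProvable.inter {x : ℕ} {C D : Concept} (hC : SProvable O Γ ((x, C) ::ₘ Δ))
    (hD : SProvable O Γ ((x, D) ::ₘ Δ)) : SProvable O Γ ((x, .inter C D) ::ₘ Δ) := by
  obtain ⟨n, hn⟩ := hC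
  obtain ⟨m, hm⟩ := hD
  exact ⟨_, .andR _ _ _ _ _ (max n m) (hn.mono (le_max_left n m)) (hm.mono (le_max_right n m))⟩

theorem SProvable.atLeast {x : ℕ} {r : Role} {C : Concept} {k : ℕ} {ys : Fin k → ℕ}
    (hpath : ∀ i, pgLang ↑Γ O r x (ys i))
    (p : ∀ i, SProvable O Γ ((ys i, C) ::ₘ (x, .atLeast k r C) ::ₘ Δ))
    (q : ∀ i j : Fin k, i < j →
      SProvable O (insert (.eq (ys i) (ys j)) Γ) ((x, .atLeast k r C) ::ₘ Δ)) :
    SProvable O Γ ((x, .atLeast k r C) ::ₘ Δ) := by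
  choose n hn using p
  choose m hm using q
  set N := Finset.univ.sup n
  set M := Finset.univ.sup fun ij : Fin k × Fin k =>
    if h : ij.1 < ij.2 then m ij.1 ij.2 h else 0 with hM
  refine ⟨_, .geR _ _ _ _ _ _ (max N M) ys hpath (fun i => (hn i).mono ?_)
    (fun i j hij => (hm i j hij).mono ?_)⟩
  · exact le_trans (Finset.le_sup (Finset.mem_univ i)) (le_max_left _ _)
  · refine le_trans ?_ (le_max_right _ _)
    have := Finset.le_sup (f := fun ij : Fin k × Fin k =>
      if h : ij.1 < ij.2 then m ij.1 ij.2 h else 0) (Finset.mem_univ (i, j))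
    simpa only [dif_pos hij] using this

end Provability

/-- A stage of proof search: a sequent together with a set of labels containing its own. -/
structure SearchState where
  labels : Finset ℕ
  ant : Finset SAtom
  suc : Multiset LC

/-- The sequent of the stage is unprovable and all its labels are recorded. -/
structure SearchState.Open (O : Ontology) (s : SearchState) : Prop where
  unprovable : ¬ SProvable O s.ant s.suc
  ant_labels : labSetF s.ant ⊆ s.labels
  suc_labels : ∀ p ∈ s.suc, p.1 ∈ s.labels

/-- The stage `t` extends `s`, and labels new in `t` come with the negated GCIs. -/
structure SearchState.Extends (O : Ontology) (s t : SearchState) : Prop where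
  labels : s.labels ⊆ t.labels
  ant : s.ant ⊆ t.ant
  gci : ∀ y ∈ t.labels, y ∉ s.labels → ∀ C ∈ O.gcis, (y, nnfNeg C) ∈ t.suc

/-- Concepts that are still present in the premises of the rules applied to them. -/
def Concept.Persistent : Concept → Prop
  | .atom _ => True
  | .nneg _ => True
  | .ex _ _ => True
  | .atLeast _ _ _ => True
  | _ => False

/-- In passing from `s` to `t`, the rule for `x : C` has been applied, with the labels in `l`
as the targets of a propagation. -/
def Treated (O : Ontology) (s t : SearchState) (x : ℕ) (l : List ℕ) : Concept → Prop
  | .atom A => ∀ y ∈ s.labels, l = [y] → eqRel s.ant x y → (y, .atom A) ∈ t.suc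
  | .nneg _ => True
  | .inter C D => (x, C) ∈ t.suc ∨ (x, D) ∈ t.suc
  | .union C D => (x, C) ∈ t.suc ∧ (x, D) ∈ t.suc
  | .ex r C => ∀ y ∈ s.labels, l = [y] → pgLang s.ant O r x y → (y, C) ∈ t.suc
  | .all r C => ∃ y ∈ t.labels, SAtom.rel r x y ∈ t.ant ∧ (y, C) ∈ t.suc
  | .atMost k r C => ∃ ys : Fin (k + 1) → ℕ,
      (∀ i, ys i ∈ t.labels ∧ SAtom.rel r x (ys i) ∈ t.ant ∧ (ys i, nnfNeg C) ∈ t.suc) ∧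
      ∀ i j, i < j → SAtom.neq (ys i) (ys j) ∈ t.ant
  | .atLeast k r C => ∀ ys : Fin k → ℕ, l = List.ofFn ys →
      (∀ i, ys i ∈ s.labels ∧ pgLang s.ant O r x (ys i)) →
      (∃ i, (ys i, C) ∈ t.suc) ∨ ∃ i j, i < j ∧ SAtom.eq (ys i) (ys j) ∈ t.ant

theorem labSetF_insert (a : SAtom) (Γ : Finset SAtom) :
    labSetF (insert a Γ) = a.labels ∪ labSetF Γ := Finset.biUnion_insert

theorem labSetF_union (Γ Γ' : Finset SAtom) : labSetF (Γ ∪ Γ') = labSetF Γ ∪ labSetF Γ' :=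
  Finset.union_biUnion

theorem fst_of_mem_obar {O : Ontology} {y : ℕ} {p : LC} (h : p ∈ obar O y) : p.1 = y := by
  obtain ⟨C, _, rfl⟩ := Multiset.mem_map.1 h
  rfl

theorem mem_obar {O : Ontology} {y : ℕ} {C : Concept} (h : C ∈ O.gcis) :
    (y, nnfNeg C) ∈ obar O y :=
  Multiset.mem_map.2 ⟨C, h, rfl⟩

namespace SearchState

variable {O : Ontology}

theorem Extends.of_labels_eq {V : Finset ℕ} {Γ Γ' : Finset SAtom} {Δ Δ' : Multiset LC}
    (h : Γ ⊆ Γ') : Extends O ⟨V, Γ, Δ⟩ ⟨V, Γ', Δ'⟩ :=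
  ⟨subset_rfl, h, fun _ hy hn => absurd hy hn⟩

/-- An open stage has an open extension in which a given labeled concept of its consequent is
processed and only this one may be lost. -/
theorem Open.exists_treated {V : Finset ℕ} {Γ : Finset SAtom} {Δ : Multiset LC} {x : ℕ}
    {C : Concept} (h : Open O ⟨V, Γ, (x, C) ::ₘ Δ⟩) (l : List ℕ) :
    ∃ t : SearchState, Open O t ∧ Extends O ⟨V, Γ, (x, C) ::ₘ Δ⟩ t ∧ (∀ q ∈ Δ, q ∈ t.suc) ∧
      (C.Persistent → (x, C) ∈ t.suc) ∧
      Treated O ⟨V, Γ, (x, C) ::ₘ Δ⟩ t x l C := by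
  obtain ⟨hu, hΓ, hΔ⟩ := h
  simp only [Multiset.mem_cons, forall_eq_or_imp] at hu hΓ hΔ
  obtain ⟨hx, hΔ⟩ := hΔ
  cases C with
  | atom A =>
    by_cases hy : ∃ y ∈ V, l = [y] ∧ eqRel Γ x y
    · obtain ⟨y, hy, rfl, he⟩ := hy
      refine ⟨⟨V, Γ, (x, .atom A) ::ₘ (y, .atom A) ::ₘ Δ⟩, ⟨?_, hΓ, ?_⟩,
        .of_labels_eq subset_rfl, ?_, ?_, ?_⟩
      · rintro ⟨n, hn⟩
        exact hu ⟨_, .subst _ _ x y _ n trivial he hn⟩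
      · simpa [hx, hy] using hΔ
      · intro q hq; simp [hq]
      · simp
      · rintro z - hz -
        simp_all
    · refine ⟨⟨V, Γ, (x, .atom A) ::ₘ Δ⟩, ⟨hu, hΓ, by simpa [hx] using hΔ⟩,
        .of_labels_eq subset_rfl, fun q hq => by simp [hq], by simp, ?_⟩
      exact fun y hy' hl he => absurd ⟨y, hy', hl, he⟩ hy
  | nneg A =>
    exact ⟨⟨V, Γ, (x, .nneg A) ::ₘ Δ⟩, ⟨hu, hΓ, by simpa [hx] using hΔ⟩,
      .of_labels_eq subset_rfl, fun q hq => by simp [hq], by simp, trivial⟩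
  | inter C D =>
    by_cases hC : SProvable O Γ ((x, C) ::ₘ Δ)
    · have hD : ¬ SProvable O Γ ((x, D) ::ₘ Δ) := fun hD => hu (hC.inter hD)
      exact ⟨⟨V, Γ, (x, D) ::ₘ Δ⟩, ⟨hD, hΓ, by simpa [hx] using hΔ⟩,
        .of_labels_eq subset_rfl, fun q hq => by simp [hq], False.elim, .inr (by simp)⟩
    · exact ⟨⟨V, Γ, (x, C) ::ₘ Δ⟩, ⟨hC, hΓ, by simpa [hx] using hΔ⟩,
        .of_labels_eq subset_rfl, fun q hq => by simp [hq], False.elim, .inl (by simp)⟩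
  | union C D =>
    refine ⟨⟨V, Γ, (x, C) ::ₘ (x, D) ::ₘ Δ⟩, ⟨?_, hΓ, by simpa [hx] using hΔ⟩,
      .of_labels_eq subset_rfl, fun q hq => by simp [hq], False.elim, by simp [Treated]⟩
    rintro ⟨n, hn⟩
    exact hu ⟨_, .orR _ _ _ _ _ n hn⟩
  | ex r C =>
    by_cases hy : ∃ y ∈ V, l = [y] ∧ pgLang Γ O r x y
    · obtain ⟨y, hy, rfl, he⟩ := hy
      refine ⟨⟨V, Γ, (x, .ex r C) ::ₘ (y, C) ::ₘ Δ⟩, ⟨?_, hΓ, ?_⟩,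
        .of_labels_eq subset_rfl, ?_, ?_, ?_⟩
      · rintro ⟨n, hn⟩
        exact hu ⟨_, .exR _ _ x y r C n he hn⟩
      · simpa [hx, hy] using hΔ
      · intro q hq; simp [hq]
      · simp
      · rintro z - hz -
        simp_all
    · refine ⟨⟨V, Γ, (x, .ex r C) ::ₘ Δ⟩, ⟨hu, hΓ, by simpa [hx] using hΔ⟩,
        .of_labels_eq subset_rfl, fun q hq => by simp [hq], by simp, ?_⟩
      exact fun y hy' hl he => absurd ⟨y, hy', hl, he⟩ hy
  | all r C =>
    obtain ⟨y, hy⟩ := Infinite.exists_notMem_finset V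
    refine ⟨⟨insert y V, insert (.rel r x y) Γ, (y, C) ::ₘ (obar O y + Δ)⟩, ⟨?_, ?_, ?_⟩,
      ⟨Finset.subset_insert _ _, Finset.subset_insert _ _, ?_⟩, fun q hq => by simp [hq],
      False.elim, y, by simp, by simp, by simp⟩
    · rintro ⟨n, hn⟩
      refine hu ⟨_, .allR _ _ x y r C n ⟨fun h => hy (hΓ h), ?_⟩ hn⟩
      simp only [Multiset.mem_cons, forall_eq_or_imp]
      exact ⟨fun e => hy (e ▸ hx), fun p hp e => hy (e ▸ hΔ p hp)⟩
    · rw [labSetF_insert]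
      refine Finset.union_subset ?_ (hΓ.trans (Finset.subset_insert _ _))
      simp [SAtom.labels, Finset.insert_subset_iff, hx]
    · intro p hp
      simp only [Multiset.mem_cons, Multiset.mem_add] at hp
      rcases hp with rfl | hp | hp
      · simp
      · simp [fst_of_mem_obar hp]
      · simp [hΔ p hp]
    · intro z hz hz' D hD
      obtain rfl : z = y := by simpa [show z ∉ V from hz'] using hz
      simp [mem_obar hD]
  | atMost k r C =>
    obtain ⟨ys, hysV, hinj⟩ : ∃ ys : Fin (k + 1) → ℕ,
        (∀ i, ys i ∉ V) ∧ Function.Injective ys := by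
      refine ⟨fun i => V.sup id + 1 + i, fun i hi => ?_, fun i j e => Fin.ext (by simpa using e)⟩
      have := Finset.le_sup (f := id) hi
      simp only [id] at this
      omega
    refine ⟨⟨V ∪ Finset.univ.image ys, Γ ∪ neqSet ys ∪ relSet r x ys, leΔ O C ys + Δ⟩,
      ⟨?_, ?_, ?_⟩, ⟨Finset.subset_union_left, ?_, ?_⟩, fun q hq => by simp [hq],
      False.elim, ys, fun i => ⟨by simp, ?_, ?_⟩, ?_⟩
    · rintro ⟨n, hn⟩
      refine hu ⟨_, .leR _ _ x r C k n ys hinj (fun i => ⟨fun h => hysV i (hΓ h), ?_⟩) hn⟩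
      simp only [Multiset.mem_cons, forall_eq_or_imp]
      exact ⟨fun e => hysV i (e ▸ hx), fun p hp e => hysV i (e ▸ hΔ p hp)⟩
    · rw [labSetF_union, labSetF_union]
      refine Finset.union_subset (Finset.union_subset ?_ ?_) ?_
      · exact hΓ.trans Finset.subset_union_left
      · intro z hz
        simp only [labSetF, neqSet, Finset.mem_biUnion, Finset.mem_image] at hz
        obtain ⟨_, ⟨p, _, rfl⟩, hz⟩ := hz
        simp only [SAtom.labels, Finset.mem_insert, Finset.mem_singleton] at hz
        rcases hz with rfl | rfl <;> simp
      · intro z hz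
        simp only [labSetF, relSet, Finset.mem_biUnion, Finset.mem_image] at hz
        obtain ⟨_, ⟨p, _, rfl⟩, hz⟩ := hz
        simp only [SAtom.labels, Finset.mem_insert, Finset.mem_singleton] at hz
        rcases hz with rfl | rfl <;> simp [hx]
    · intro p hp
      rcases Multiset.mem_add.1 hp with hp | hp
      · obtain ⟨i, rfl | hp⟩ := mem_leΔ.1 hp
        · simp
        · simp [fst_of_mem_obar hp]
      · simp [hΔ p hp]
    · exact Finset.subset_union_left.trans Finset.subset_union_left
    · intro z hz hz' D hD
      obtain ⟨i, rfl⟩ : ∃ i, ys i = z := by simpa [show z ∉ V from hz'] using hz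
      exact Multiset.mem_add.2 (.inl (mem_leΔ.2 ⟨i, .inr (mem_obar hD)⟩))
    · simp [relSet]
    · exact Multiset.mem_add.2 (.inl (mem_leΔ.2 ⟨i, .inl rfl⟩))
    · intro i j hij
      simp only [Finset.mem_union]
      exact .inl (.inr (Finset.mem_image.2 ⟨(i, j), by simpa using hij, rfl⟩))
  | atLeast k r C =>
    by_cases hy : ∃ ys : Fin k → ℕ, l = List.ofFn ys ∧
        ∀ i, ys i ∈ V ∧ pgLang Γ O r x (ys i)
    · obtain ⟨ys, rfl, hys⟩ := hy
      have hl : ∀ zs : Fin k → ℕ, List.ofFn ys = List.ofFn zs → zs = ys :=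
        fun zs e => (List.ofFn_injective e).symm
      by_cases hp : ∀ i, SProvable O Γ ((ys i, C) ::ₘ (x, .atLeast k r C) ::ₘ Δ)
      · have hq : ¬ ∀ i j : Fin k, i < j →
            SProvable O (insert (.eq (ys i) (ys j)) Γ) ((x, .atLeast k r C) ::ₘ Δ) :=
          fun hq => hu (.atLeast (fun i => (hys i).2) hp hq)
        push Not at hq
        obtain ⟨i, j, hij, hq⟩ := hq
        refine ⟨⟨V, insert (.eq (ys i) (ys j)) Γ, (x, .atLeast k r C) ::ₘ Δ⟩,
          ⟨hq, ?_, by simpa [hx] using hΔ⟩, .of_labels_eq (Finset.subset_insert _ _),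
          fun q hq => by simp [hq], by simp, ?_⟩
        · rw [labSetF_insert]
          refine Finset.union_subset ?_ hΓ
          simp [SAtom.labels, Finset.insert_subset_iff, (hys i).1, (hys j).1]
        · intro zs e _
          rw [hl zs e]
          exact .inr ⟨i, j, hij, by simp⟩
      · push Not at hp
        obtain ⟨i, hp⟩ := hp
        refine ⟨⟨V, Γ, (ys i, C) ::ₘ (x, .atLeast k r C) ::ₘ Δ⟩, ⟨hp, hΓ, ?_⟩,
          .of_labels_eq subset_rfl, fun q hq => by simp [hq], by simp, ?_⟩
        · simpa [hx, (hys i).1] using hΔ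
        · intro zs e _
          rw [hl zs e]
          exact .inl ⟨i, by simp⟩
    · refine ⟨⟨V, Γ, (x, .atLeast k r C) ::ₘ Δ⟩, ⟨hu, hΓ, by simpa [hx] using hΔ⟩,
        .of_labels_eq subset_rfl, fun q hq => by simp [hq], by simp, ?_⟩
      exact fun ys hl hys => absurd ⟨ys, hl, hys⟩ hy

theorem Open.exists_step {s : SearchState} (h : s.Open O) (p : LC) (l : List ℕ) :
    ∃ t : SearchState, t.Open O ∧ s.Extends O t ∧
      (∀ q ∈ s.suc, q ≠ p ∨ q.2.Persistent → q ∈ t.suc) ∧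
      (p ∈ s.suc → Treated O s t p.1 l p.2) := by
  by_cases hp : p ∈ s.suc
  · obtain ⟨V, Γ, Δ'⟩ := s
    obtain ⟨Δ, rfl⟩ := Multiset.exists_cons_of_mem hp
    obtain ⟨t, ht, hext, hΔ, hpers, hproc⟩ := h.exists_treated (C := p.2) l
    refine ⟨t, ht, hext, fun q hq hqp => ?_, fun _ => hproc⟩
    rcases Multiset.mem_cons.1 hq with rfl | hq
    · exact hpers (hqp.resolve_left (· rfl))
    · exact hΔ q hq
  · exact ⟨s, h, ⟨subset_rfl, subset_rfl, fun _ hy hn => absurd hy hn⟩, fun q hq _ => hq,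
      fun h => absurd h hp⟩

end SearchState

/-! ### Completeness -/

/-- An injective numbering of roles. -/
def Role.code : Role → ℕ
  | .name n => Nat.pair 0 n
  | .inv n => Nat.pair 1 n

/-- An injective numbering of concepts. -/
def Concept.code : Concept → ℕ
  | .atom A => Nat.pair 0 A
  | .nneg A => Nat.pair 1 A
  | .inter C D => Nat.pair 2 (Nat.pair C.code D.code)
  | .union C D => Nat.pair 3 (Nat.pair C.code D.code)
  | .ex r C => Nat.pair 4 (Nat.pair r.code C.code)
  | .all r C => Nat.pair 5 (Nat.pair r.code C.code)
  | .atMost n r C => Nat.pair 6 (Nat.pair n (Nat.pair r.code C.code))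
  | .atLeast n r C => Nat.pair 7 (Nat.pair n (Nat.pair r.code C.code))

theorem Role.code_injective : Function.Injective Role.code := by
  intro r s h
  cases r <;> cases s <;> simp_all [Role.code, Nat.pair_eq_pair]

theorem Concept.code_injective : Function.Injective Concept.code := by
  intro C
  induction C <;> intro D h <;> cases D <;>
    simp only [Concept.code, Nat.pair_eq_pair, Role.code_injective.eq_iff] at h <;>
    grind

instance : Countable Concept := Concept.code_injective.countable

/-- Every member of a nonempty countable type can be listed infinitely often. -/
theorem exists_frequently_eq (α : Type*) [Countable α] [Nonempty α] :
    ∃ g : ℕ → α, ∀ a N, ∃ n ≥ N, g n = a := by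
  obtain ⟨f, hf⟩ := exists_surjective_nat α
  refine ⟨fun n => f n.unpair.1, fun a N => ?_⟩
  obtain ⟨m, rfl⟩ := hf a
  exact ⟨Nat.pair m N, Nat.right_le_pair m N, by simp⟩

/-- A fair run of proof search through open stages. -/
structure FairRun (O : Ontology) (s : ℕ → SearchState) (task : ℕ → LC × List ℕ) : Prop where
  isOpen : ∀ n, (s n).Open O
  ext : ∀ n, (s n).Extends O (s (n + 1))
  keep : ∀ n, ∀ q ∈ (s n).suc, q ≠ (task n).1 ∨ q.2.Persistent → q ∈ (s (n + 1)).suc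
  process : ∀ n, (task n).1 ∈ (s n).suc →
    Treated O (s n) (s (n + 1)) (task n).1.1 (task n).2 (task n).1.2
  fair : ∀ t N, ∃ n ≥ N, task n = t

theorem exists_fairRun {O : Ontology} {s₀ : SearchState} (h : s₀.Open O) :
    ∃ s task, FairRun O s task ∧ s 0 = s₀ := by
  have : Nonempty (LC × List ℕ) := ⟨((0, .atom 0), [])⟩
  obtain ⟨task, htask⟩ := exists_frequently_eq (LC × List ℕ)
  choose step hstep using fun (n : ℕ) (s : {s : SearchState // s.Open O}) =>
    s.2.exists_step (task n).1 (task n).2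
  let s : ℕ → {s : SearchState // s.Open O} := fun n =>
    Nat.rec ⟨s₀, h⟩ (fun n s => ⟨step n s, (hstep n s).1⟩) n
  exact ⟨fun n => (s n).1, task, ⟨fun n => (s n).2, fun n => (hstep n (s n)).2.1,
    fun n => (hstep n (s n)).2.2.1, fun n => (hstep n (s n)).2.2.2, htask⟩, rfl⟩

namespace FairRun

variable {O : Ontology} {s : ℕ → SearchState} {task : ℕ → LC × List ℕ}
  (hs : FairRun O s task)
include hs

theorem labels_mono : Monotone fun n => (s n).labels :=
  monotone_nat_of_le_succ fun n => (hs.ext n).labels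

theorem ant_mono : Monotone fun n => ((s n).ant : Set SAtom) :=
  monotone_nat_of_le_succ fun n => Finset.coe_subset.2 (hs.ext n).ant

theorem mem_suc_of_le {p : LC} (hp : p.2.Persistent) {n m : ℕ} (hnm : n ≤ m)
    (h : p ∈ (s n).suc) : p ∈ (s m).suc := by
  induction m, hnm using Nat.le_induction with
  | base => exact h
  | succ m _ ih => exact hs.keep m p ih (.inr hp)

theorem exists_treated_of_persistent {p : LC} (hp : p.2.Persistent) {n : ℕ}
    (h : p ∈ (s n).suc) (l : List ℕ) (N : ℕ) :
    ∃ m ≥ N, Treated O (s m) (s (m + 1)) p.1 l p.2 := by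
  obtain ⟨m, hm, ht⟩ := hs.fair (p, l) (max n N)
  refine ⟨m, le_of_max_le_right hm, ?_⟩
  have := hs.process m
  rw [ht] at this
  exact this (hs.mem_suc_of_le hp (le_of_max_le_left hm) h)

theorem exists_treated {p : LC} {n : ℕ} (h : p ∈ (s n).suc) :
    ∃ m l, Treated O (s m) (s (m + 1)) p.1 l p.2 := by
  by_contra hno
  push Not at hno
  have hmem : ∀ m ≥ n, p ∈ (s m).suc := by
    intro m hm
    induction m, hm using Nat.le_induction with
    | base => exact h
    | succ m _ ih =>
      refine hs.keep m p ih (.inl fun e => hno m (task m).2 ?_)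
      subst e
      exact hs.process m ih
  obtain ⟨m, hm, ht⟩ := hs.fair (p, []) n
  have := hs.process m
  rw [ht] at this
  exact hno m [] (this (hmem m hm))

/-- The limit of a fair run is a Hintikka structure. -/
theorem hintikka (h0 : ∀ y ∈ (s 0).labels, ∀ C ∈ O.gcis, (y, nnfNeg C) ∈ (s 0).suc) :
    Hintikka O {y | ∃ n, y ∈ (s n).labels} (⋃ n, ((s n).ant : Set SAtom))
      {p | ∃ n, p ∈ (s n).suc} where
  gci := by
    rintro x ⟨n, hn⟩ C hC
    induction n with
    | zero => exact ⟨0, h0 x hn C hC⟩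
    | succ n ih =>
      by_cases hx : x ∈ (s n).labels
      · exact ih hx
      · exact ⟨n + 1, (hs.ext n).gci x hn hx C hC⟩
  clash := by
    rintro x A ⟨n, hn⟩ ⟨m, hm⟩
    have hn' := hs.mem_suc_of_le (p := (x, .atom A)) trivial (le_max_left n m) hn
    have hm' := hs.mem_suc_of_le (p := (x, .nneg A)) trivial (le_max_right n m) hm
    obtain ⟨Δ, hΔ⟩ := Multiset.exists_cons_of_mem hn'
    rw [hΔ, Multiset.mem_cons] at hm'
    obtain ⟨Δ', rfl⟩ := Multiset.exists_cons_of_mem (hm'.resolve_left (by simp))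
    refine (hs.isOpen (max n m)).unprovable ⟨0, ?_⟩
    rw [hΔ]
    exact .id _ _ _ _ _
  neq := by
    intro x y hxy he
    obtain ⟨n, hn⟩ := Set.mem_iUnion.1 hxy
    obtain ⟨m, hm⟩ := exists_eqRel_of_iUnion hs.ant_mono he
    exact (hs.isOpen (max n m)).unprovable ⟨0, .idEq _ _ x y _
      (hs.ant_mono (le_max_left n m) hn) (hm.mono (hs.ant_mono (le_max_right n m)))⟩
  subst := by
    rintro x A ⟨n, hn⟩ y ⟨k, hk⟩ he
    obtain ⟨m, hm⟩ := exists_eqRel_of_iUnion hs.ant_mono he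
    obtain ⟨i, hi, hproc⟩ := hs.exists_treated_of_persistent (p := (x, .atom A))
      trivial hn [y] (max k m)
    exact ⟨i + 1, hproc y (hs.labels_mono (le_of_max_le_left hi) hk) rfl
      (hm.mono (hs.ant_mono (le_of_max_le_right hi)))⟩
  inter := by
    rintro x C D ⟨n, hn⟩
    obtain ⟨m, l, hproc⟩ := hs.exists_treated hn
    exact hproc.imp (fun h => ⟨m + 1, h⟩) (fun h => ⟨m + 1, h⟩)
  union := by
    rintro x C D ⟨n, hn⟩
    obtain ⟨m, l, hproc⟩ := hs.exists_treated hn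
    exact hproc.imp (fun h => ⟨m + 1, h⟩) (fun h => ⟨m + 1, h⟩)
  ex := by
    rintro x r C ⟨n, hn⟩ y ⟨k, hk⟩ he
    obtain ⟨m, hm⟩ := exists_pgLang_of_iUnion hs.ant_mono he
    obtain ⟨i, hi, hproc⟩ := hs.exists_treated_of_persistent (p := (x, .ex r C))
      trivial hn [y] (max k m)
    exact ⟨i + 1, hproc y (hs.labels_mono (le_of_max_le_left hi) hk) rfl
      (hm.mono (hs.ant_mono (le_of_max_le_right hi)))⟩
  all := by
    rintro x r C ⟨n, hn⟩
    obtain ⟨m, l, y, hy, hr, hC⟩ := hs.exists_treated hn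
    exact ⟨y, ⟨m + 1, hy⟩, Set.mem_iUnion.2 ⟨m + 1, hr⟩, m + 1, hC⟩
  atMost := by
    rintro x k r C ⟨n, hn⟩
    obtain ⟨m, l, ys, hys, hne⟩ := hs.exists_treated hn
    exact ⟨ys, fun i => ⟨⟨m + 1, (hys i).1⟩, Set.mem_iUnion.2 ⟨m + 1, (hys i).2.1⟩,
      m + 1, (hys i).2.2⟩, fun i j hij => Set.mem_iUnion.2 ⟨m + 1, hne i j hij⟩⟩
  atLeast := by
    rintro x k r C ⟨n, hn⟩ ys hys
    choose a ha using fun i => (hys i).1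
    choose b hb using fun i => exists_pgLang_of_iUnion hs.ant_mono (hys i).2
    obtain ⟨m, hm, hproc⟩ := hs.exists_treated_of_persistent (p := (x, .atLeast k r C))
      trivial hn (List.ofFn ys)
      (max (Finset.univ.sup a) (Finset.univ.sup b))
    have hle : ∀ i, a i ≤ m ∧ b i ≤ m := fun i =>
      ⟨(Finset.le_sup (Finset.mem_univ i)).trans (le_of_max_le_left hm),
        (Finset.le_sup (Finset.mem_univ i)).trans (le_of_max_le_right hm)⟩
    rcases hproc ys rfl (fun i => ⟨hs.labels_mono (hle i).1 (ha i),
        (hb i).mono (hs.ant_mono (hle i).2)⟩) with ⟨i, hi⟩ | ⟨i, j, hij, he⟩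
    · exact .inl ⟨i, m + 1, hi⟩
    · exact .inr ⟨i, j, hij, .single (.inl (Set.mem_iUnion.2 ⟨m + 1, he⟩))⟩

end FairRun

/-- O ⊨ C ⊑ D iff S(O) ⊩ ∅ ⊢ x : O̅, x : ¬̇C ⊔ D. -/
theorem entails_iff_provable (O : Ontology) (C D : Concept) (x : ℕ) :
    entails O C D ↔ SProvable O ∅ ((x, Concept.union (nnfNeg C) D) ::ₘ obar O x) := by
  constructor
  · intro hent
    by_contra hun
    obtain ⟨s, task, hs, hs₀⟩ := exists_fairRun (O := O)
      (s₀ := ⟨{x}, ∅, (x, Concept.union (nnfNeg C) D) ::ₘ obar O x⟩)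
      ⟨hun, by simp [labSetF], fun p hp => by
        rcases Multiset.mem_cons.1 hp with rfl | hp
        · simp
        · simp [fst_of_mem_obar hp]⟩
    have hH := hs.hintikka (by
      rw [hs₀]
      intro y hy E hE
      obtain rfl : y = x := by simpa using hy
      exact Multiset.mem_cons_of_mem (mem_obar hE))
    let x₀ : {y | ∃ n, y ∈ (s n).labels} := ⟨x, 0, by simp [hs₀]⟩
    have hx := hH.not_mem_cInterp (Concept.union (nnfNeg C) D) x₀
      ⟨0, by rw [hs₀]; exact Multiset.mem_cons_self _ _⟩
    have : Nonempty (TermDomain {y | ∃ n, y ∈ (s n).labels}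
      (⋃ n, ((s n).ant : Set SAtom))) := ⟨Quotient.mk _ x₀⟩
    refine hx (or_iff_not_imp_left.2 fun hC => hent _ _ hH.models_termModel ?_)
    rwa [Interp.mem_cInterp_nnfNeg, not_not] at hC
  · rintro ⟨n, hn⟩ δ _ I hI a ha
    have := hn.validSeq δ I (fun _ => a) hI (by simp [satAll])
    rcases satEx_cons.1 this with (h | h) | h
    · exact absurd ha (I.mem_cInterp_nnfNeg.1 h)
    · exact h
    · exact absurd h hI.not_satEx_obar


end RIQ
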